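/- arXiv:2106.08923 — 7 statements merged into one kernel-verified Lean document; each statement's English description precedes it below -/
import Mathlib

section
/- Let p_1, …, p_n ∈ ℝ^d and let l : ℝ^d → ℝ^d be an invertible linear map. Set q_i = l(p_i) for each i. Then the hyperconnectivity matroids of p and of q coincide: for every set E of pairs {i,j} with 1 ≤ i < j ≤ n, the rows of the hyperconnectivity matrix H(p) indexed by E are linearly independent if and only if the rows of H(q) indexed by E are linearly independent. -/
/-- Row of the hyperconnectivity matrix indexed by the ordered pair `e = (i, j)`:
block `i` contains `p j`, block `j` contains `-p i`, other blocks are zero. -/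
def hypRow {n d : ℕ} (p : Fin n → Fin d → ℝ) (e : Fin n × Fin n) :
    Fin n → Fin d → ℝ :=
  fun k => if k = e.1 then p e.2 else if k = e.2 then -p e.1 else 0

/-- The hyperconnectivity matroid is invariant under a global invertible linear
transformation of the point configuration. -/
theorem hyperconnectivity_invariant_linearMap
    (d n : ℕ) (p q : Fin n → Fin d → ℝ)
    (l : (Fin d → ℝ) →ₗ[ℝ] (Fin d → ℝ)) (hl : Function.Bijective l)
    (hq : ∀ i, q i = l (p i))
    (E : Set (Fin n × Fin n)) (hE : ∀ e ∈ E, e.1 < e.2) :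
    LinearIndependent ℝ (fun e : E => hypRow p e.1) ↔
      LinearIndependent ℝ (fun e : E => hypRow q e.1) := by
  have hL : LinearMap.ker (l.compLeft (Fin n)) = ⊥ := by
    rw [LinearMap.ker_eq_bot]
    intro x y hxy
    funext k
    exact hl.1 (congrFun hxy k)
  have hrow : (fun e : E => hypRow q e.1) =
      (l.compLeft (Fin n)) ∘ (fun e : E => hypRow p e.1) := by
    funext e k
    simp only [hypRow, Function.comp_apply, LinearMap.compLeft_apply]
    split_ifs <;> simp [hq]
  rw [hrow]
  exact ((l.compLeft (Fin n)).linearIndependent_iff hL).symm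
end

section
/- Let d = 2k be even and n ≥ 1. Consider the polynomial ring ℝ[a_{l,i}, b_{l,i} : 1 ≤ l ≤ k, 1 ≤ i ≤ n] and, for each pair 1 ≤ i < j ≤ n, the polynomial T_{ij} = Σ_{l=1}^{k} (a_{l,i} b_{l,j} − a_{l,j} b_{l,i}). Then for every set S of pairs {i,j}, the family of polynomials {T_{ij} : {i,j} ∈ S} is algebraically independent over ℝ if and only if there exist vectors p_1, …, p_n ∈ ℝ^{2k} such that the rows of the hyperconnectivity matrix H(p) indexed by S are linearly independent. (That is, for even d the hyperconnectivity matroid H_d(n) in generic position equals the algebraic matroid of n×n skew-symmetric matrices of rank at most d.) -/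
/-- The entry `T_{ij} = Σ_{l=1}^{k} (a_{l,i} b_{l,j} − a_{l,j} b_{l,i})` of the generic
`n × n` skew-symmetric matrix of rank at most `2k`, as a polynomial in the variables
`a_{l,i}` (indexed by `Sum.inl (l, i)`) and `b_{l,i}` (indexed by `Sum.inr (l, i)`). -/
noncomputable def skewEntry (k n : ℕ) (e : Fin n × Fin n) :
    MvPolynomial ((Fin k × Fin n) ⊕ (Fin k × Fin n)) ℝ :=
  ∑ l : Fin k,
    (MvPolynomial.X (Sum.inl (l, e.1)) * MvPolynomial.X (Sum.inr (l, e.2)) -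
      MvPolynomial.X (Sum.inl (l, e.2)) * MvPolynomial.X (Sum.inr (l, e.1)))

open MvPolynomial in
/-- Chain rule for `aeval`. -/
theorem hyp_chain {σ ι : Type*} [Fintype ι] (f : ι → MvPolynomial σ ℝ)
    (F : MvPolynomial ι ℝ) (s : σ) :
    pderiv s (aeval f F) = ∑ i, aeval f (pderiv i F) * pderiv s (f i) := by
  classical
  induction F using MvPolynomial.induction_on with
  | C a => simp [← algebraMap_eq]
  | add p q hp hq => simp only [map_add, hp, hq, add_mul, Finset.sum_add_distrib]
  | mul_X p j hp =>
    simp only [map_mul, aeval_X, pderiv_mul, hp, map_add, pderiv_X, add_mul,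
      Finset.sum_add_distrib, Finset.sum_mul]
    congr 1
    · exact Finset.sum_congr rfl fun i _ => by ring
    · rw [Finset.sum_eq_single j]
      · simp
      · intro b _ hb
        simp [Pi.single_eq_of_ne hb.symm]
      · simp

open MvPolynomial in
theorem hyp_mkDer {σ : Type*} [Fintype σ] (K : Type*) [Field K] [Algebra ℝ K]
    [Algebra (MvPolynomial σ ℝ) K] [IsScalarTower ℝ (MvPolynomial σ ℝ) K]
    (v : σ → K) (F : MvPolynomial σ ℝ) :
    mkDerivation ℝ v F = ∑ s, algebraMap _ K (pderiv s F) * v s := by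
  classical
  induction F using MvPolynomial.induction_on with
  | C a => simp
  | add p q hp hq => simp only [map_add, hp, hq, add_mul, Finset.sum_add_distrib]
  | mul_X p j hp =>
    simp only [Derivation.leibniz, hp, mkDerivation_X, pderiv_X, map_add,
      add_mul, Finset.sum_add_distrib, smul_eq_mul, map_mul, Algebra.smul_def, Finset.mul_sum]
    congr 1
    · rw [Finset.sum_eq_single j]
      · simp
      · intro b _ hb
        simp [Pi.single_eq_of_ne hb.symm]
      · simp
    · exact Finset.sum_congr rfl fun i _ => by ring

open MvPolynomial in
theorem hyp_const {ι : Type*} (F : MvPolynomial ι ℝ) (h : ∀ i, pderiv i F = 0) :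
    F = C (coeff 0 F) := by
  classical
  ext m
  rw [coeff_C]
  split_ifs with hm
  · rw [hm]
  · obtain ⟨i, hi⟩ : ∃ i, m i ≠ 0 := by
      by_contra! hc
      exact hm (by ext i; simp [hc i])
    have h1 := congrArg (coeff (m - Finsupp.single i 1)) (h i)
    rw [coeff_pderiv, coeff_zero] at h1
    have h2 : m - Finsupp.single i 1 + Finsupp.single i 1 = m := by
      apply tsub_add_cancel_of_le
      simpa [Finsupp.single_le_iff] using Nat.one_le_iff_ne_zero.2 hi
    rw [h2] at h1
    rcases mul_eq_zero.1 h1 with h3 | h3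
    · exact h3
    · exfalso
      have : (0 : ℝ) ≤ ((m - Finsupp.single i 1 : ι →₀ ℕ) i : ℕ) := Nat.cast_nonneg _
      linarith

open MvPolynomial in
theorem hyp_deg {ι : Type*} (F : MvPolynomial ι ℝ) (i : ι) (n : ℕ)
    (h : F.totalDegree ≤ n + 1) : (pderiv i F).totalDegree ≤ n := by
  classical
  refine Finset.sup_le ?_
  intro m hm
  rw [mem_support_iff, coeff_pderiv] at hm
  have := (le_totalDegree (mem_support_iff.2 (left_ne_zero_of_mul hm))).trans h
  rw [Finsupp.sum_add_index' (by simp) (by simp), Finsupp.sum_single_index rfl] at this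
  omega

open MvPolynomial in
/-- Jacobian rows independent over the polynomial ring imply algebraic independence. -/
theorem hyp_algInd {σ ι : Type*} [Fintype ι] (f : ι → MvPolynomial σ ℝ)
    (hf : ∀ c : ι → MvPolynomial σ ℝ, (∀ s, ∑ i, c i * pderiv s (f i) = 0) → c = 0) :
    AlgebraicIndependent ℝ f := by
  rw [algebraicIndependent_iff]
  suffices H : ∀ n : ℕ, ∀ F : MvPolynomial ι ℝ, F.totalDegree ≤ n → aeval f F = 0 → F = 0 from
    fun F hF => H _ F le_rfl hF
  have key : ∀ F : MvPolynomial ι ℝ, (∀ i, pderiv i F = 0) → aeval f F = 0 → F = 0 := by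
    intro F h hF
    rw [hyp_const F h] at hF ⊢
    rw [aeval_C, algebraMap_eq] at hF
    simpa using hF
  intro n
  induction n with
  | zero =>
    intro F hF h0
    refine key F (fun i => ?_) h0
    rw [totalDegree_eq_zero_iff_eq_C.1 (Nat.le_zero.1 hF)]
    simp
  | succ n ih =>
    intro F hF h0
    refine key F (fun i => ih _ (hyp_deg F i n hF) ?_) h0
    have := hf (fun i => aeval f (pderiv i F)) (fun s => by rw [← hyp_chain, h0, map_zero])
    exact congrFun this i

open MvPolynomial in
theorem hyp_back {σ ι : Type*} [Fintype σ] [Fintype ι] (f : ι → MvPolynomial σ ℝ)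
    (x : σ → ℝ) (hx : LinearIndependent ℝ (fun i s => eval x (pderiv s (f i)))) :
    AlgebraicIndependent ℝ f := by
  classical
  apply hyp_algInd
  intro c hc
  have hinj := linearIndependent_iff_injective_fintypeLinearCombination.1 hx
  obtain ⟨g, hg⟩ := LinearMap.exists_leftInverse_of_injective _ (LinearMap.ker_eq_bot.2 hinj)
  let W : Matrix σ ι (MvPolynomial σ ℝ) := fun s i => C (g (Pi.single s 1) i)
  let J : Matrix ι σ (MvPolynomial σ ℝ) := fun i s => pderiv s (f i)
  let M : Matrix ι ι (MvPolynomial σ ℝ) := J * W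
  have h1 : M.map (eval x) = 1 := by
    ext i j
    have h2 := congrFun (LinearMap.congr_fun hg (Pi.single i 1)) j
    simp only [LinearMap.comp_apply, Fintype.linearCombination_apply_single, one_smul,
      LinearMap.id_apply] at h2
    rw [pi_eq_sum_univ' (fun s => eval x (pderiv s (f i)))] at h2
    simp only [map_sum, map_smul, Finset.sum_apply, Pi.smul_apply, smul_eq_mul] at h2
    have h3 : M i j = ∑ s, pderiv s (f i) * C (g (Pi.single s 1) j) := Matrix.mul_apply
    rw [Matrix.map_apply, h3, map_sum]
    simp only [map_mul, eval_C]
    rw [Matrix.one_apply, h2, Pi.single_apply]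
    simp [eq_comm]
  have hdet : M.det ≠ 0 := by
    intro h0
    have := congrArg (eval x) h0
    rw [RingHom.map_det, RingHom.mapMatrix_apply, h1] at this
    simp at this
  refine Matrix.eq_zero_of_vecMul_eq_zero hdet ?_
  simp only [M]
  rw [← Matrix.vecMul_vecMul]
  have : Matrix.vecMul c J = 0 := by
    ext1 s
    exact hc s
  rw [this, Matrix.zero_vecMul]

open Polynomial in
theorem hyp_sep {A R : Type*} [CommRing A] [CommRing R] [IsDomain A] [CharZero A] [Algebra A R]
    [FaithfulSMul A R] (x : R) :
    ∀ n : ℕ, ∀ P : A[X], P.natDegree ≤ n → P ≠ 0 → aeval x P = 0 →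
      ∃ Q : A[X], aeval x Q = 0 ∧ aeval x (derivative Q) ≠ 0 := by
  intro n
  induction n with
  | zero =>
    intro P hP h0 hx
    rw [Polynomial.eq_C_of_natDegree_le_zero hP] at h0 hx
    rw [aeval_C, FaithfulSMul.algebraMap_eq_zero_iff] at hx
    simp [hx] at h0
  | succ n ih =>
    intro P hP h0 hx
    by_cases h : aeval x (derivative P) = 0
    · by_cases hd : P.natDegree = 0
      · exact ih P (by omega) h0 hx
      · refine ih (derivative P) ?_ ?_ h
        · have := natDegree_derivative_lt hd
          omega
        · intro h3
          exact hd (derivative_eq_zero.1 h3)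
    · exact ⟨P, hx, h⟩

open MvPolynomial in
theorem hyp_fwd {σ ι : Type} [Fintype σ] [Fintype ι] (K : Type) [Field K]
    [Algebra (MvPolynomial σ ℝ) K] [IsFractionRing (MvPolynomial σ ℝ) K] [Algebra ℝ K]
    [IsScalarTower ℝ (MvPolynomial σ ℝ) K] (f : ι → MvPolynomial σ ℝ)
    (hf : AlgebraicIndependent ℝ f) :
    ∃ x : σ → ℝ, LinearIndependent ℝ (fun i s => eval x (pderiv s (f i))) := by
  classical
  obtain ⟨t, hst, ht⟩ := exists_isTranscendenceBasis_superset (R := ℝ) hf.coe_range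
  have hcard := ht.cardinalMk_eq (IsTranscendenceBasis.mvPolynomial σ ℝ)
  have : Finite t := by
    rw [← Cardinal.mk_lt_aleph0_iff, hcard]
    exact Cardinal.mk_lt_aleph0
  have : Fintype t := Fintype.ofFinite t
  have hcard' : Fintype.card t = Fintype.card σ := by
    simpa using hcard
  let R := MvPolynomial σ ℝ
  let L : (σ → K) →ₗ[K] (t → K) :=
    { toFun := fun v b => ∑ s, algebraMap R K (pderiv s b.1) * v s
      map_add' := by
        intro v w
        ext b
        simp [mul_add, Finset.sum_add_distrib]
      map_smul' := by
        intro c v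
        ext b
        simp only [Pi.smul_apply, smul_eq_mul, RingHom.id_apply, Finset.mul_sum]
        exact Finset.sum_congr rfl fun _ _ => by ring }
  have hinj : Function.Injective L := by
    rw [← LinearMap.ker_eq_bot, LinearMap.ker_eq_bot']
    intro v hv
    let D : Derivation ℝ R K := mkDerivation ℝ v
    have hD : ∀ b ∈ t, D b = 0 := by
      intro b hb
      exact (hyp_mkDer K v b).trans (congrFun hv ⟨b, hb⟩)
    let A := Algebra.adjoin ℝ (Set.range ((↑) : t → R))
    have hDA : ∀ a : A, D a.1 = 0 := by
      intro a
      have h0 : Set.EqOn D (0 : Derivation ℝ R K) (Set.range ((↑) : t → R)) := by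
        rintro _ ⟨b, rfl⟩
        simpa using hD b.1 b.2
      simpa using Derivation.eqOn_adjoin h0 a.2
    let D' : Derivation A R K :=
      Derivation.mk'
        { toFun := D
          map_add' := fun a b => map_add D a b
          map_smul' := by
            intro a r
            rw [Algebra.smul_def, Derivation.leibniz]
            have : D (algebraMap A R a) = 0 := hDA a
            rw [this, smul_zero, add_zero, RingHom.id_apply]
            rw [algebraMap_smul] }
        (fun a b => D.leibniz a b)
    have halg : Algebra.IsAlgebraic A R := ht.isAlgebraic
    ext s
    obtain ⟨P, hP0, hP⟩ := halg.isAlgebraic (X s : R)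
    obtain ⟨Q, hQ, hQ'⟩ := hyp_sep (X s : R) _ P le_rfl hP0 hP
    have h1 := D'.map_aeval Q (X s : R)
    rw [hQ, map_zero] at h1
    have h2 : D' (X s : R) = v s := mkDerivation_X ℝ v s
    rw [h2, Algebra.smul_def] at h1
    rcases mul_eq_zero.1 h1.symm with h3 | h3
    · exact absurd ((FaithfulSMul.algebraMap_eq_zero_iff R K).1 h3) hQ'
    · exact h3
  have hsurj : Function.Surjective L :=
    (LinearMap.injective_iff_surjective_of_finrank_eq_finrank (by simp [hcard'])).1 hinj
  have hfi : ∀ i, f i ∈ t := fun i => hst ⟨i, rfl⟩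
  choose v hv using fun i => hsurj (Pi.single ⟨f i, hfi i⟩ 1)
  have hv' : ∀ i j, ∑ s, algebraMap R K (pderiv s (f j)) * v i s = if i = j then 1 else 0 := by
    intro i j
    have h1 := congrFun (hv i) ⟨f j, hfi j⟩
    refine h1.trans ?_
    by_cases hij : i = j
    · subst hij; simp
    · rw [if_neg hij, Pi.single_eq_of_ne]
      intro h
      exact hij (hf.injective (congrArg Subtype.val h)).symm
  obtain ⟨g, hg⟩ := IsLocalization.exist_integer_multiples_of_finite (nonZeroDivisors R)
    (fun q : ι × σ => v q.1 q.2)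
  choose w hw using hg
  have hw' : ∀ i j, ∑ s, pderiv s (f j) * w (i, s) = if i = j then g.1 else 0 := by
    intro i j
    apply FaithfulSMul.algebraMap_injective R K
    have h1 := congrArg (fun z => algebraMap R K g.1 * z) (hv' i j)
    simp only [Finset.mul_sum] at h1
    rw [map_sum]
    convert h1 using 1
    · refine Finset.sum_congr rfl fun s _ => ?_
      rw [map_mul, hw, Algebra.smul_def]
      ring
    · split_ifs <;> simp
  have hg0 : g.1 ≠ 0 := nonZeroDivisors.ne_zero g.2
  obtain ⟨x, hx⟩ : ∃ x, eval x g.1 ≠ 0 := by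
    by_contra! h
    exact hg0 (MvPolynomial.funext (fun x => by simpa using h x))
  refine ⟨x, ?_⟩
  rw [Fintype.linearIndependent_iff]
  intro c hc i
  have h1 : ∑ s, (∑ j, c j * eval x (pderiv s (f j))) * eval x (w (i, s)) = 0 := by
    refine Finset.sum_eq_zero fun s _ => ?_
    have := congrFun hc s
    simp only [Finset.sum_apply, Pi.smul_apply, smul_eq_mul, Pi.zero_apply] at this
    rw [this, zero_mul]
  simp only [Finset.sum_mul] at h1
  rw [Finset.sum_comm] at h1
  have h2 : ∀ j, ∑ s, c j * eval x (pderiv s (f j)) * eval x (w (i, s))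
      = c j * if i = j then eval x g.1 else 0 := by
    intro j
    have := congrArg (eval x) (hw' i j)
    rw [map_sum] at this
    simp only [map_mul] at this
    simp only [mul_assoc, ← Finset.mul_sum]
    rw [this]
    split_ifs <;> simp
  simp only [h2] at h1
  simp at h1
  exact h1.resolve_right hx

/-- Coordinates: `Fin (2k)` as two copies of `Fin k`. -/
def hypIdx (k : ℕ) : Fin k ⊕ Fin k ≃ Fin (2 * k) :=
  finSumFinEquiv.trans (finCongr (by omega))

/-- Rearranging coordinates: `(a, b)`-derivatives to blocks. -/
def hypLin (k n : ℕ) : (Fin n → Fin (2 * k) → ℝ) ≃ₗ[ℝ] ((Fin k × Fin n) ⊕ (Fin k × Fin n) → ℝ) where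
  toFun r := Sum.elim (fun q => r q.2 (hypIdx k (Sum.inl q.1)))
    (fun q => r q.2 (hypIdx k (Sum.inr q.1)))
  map_add' r r' := by ext (q | q) <;> simp
  map_smul' c r := by ext (q | q) <;> simp
  invFun y := fun m u => Sum.elim (fun l => y (Sum.inl (l, m))) (fun l => y (Sum.inr (l, m)))
    ((hypIdx k).symm u)
  left_inv r := by
    ext m u
    obtain ⟨u, rfl⟩ := (hypIdx k).surjective u
    rcases u with u | u <;> simp
  right_inv y := by ext (q | q) <;> simp

open MvPolynomial in
theorem hyp_jac (k n : ℕ) (e : Fin n × Fin n) (he : e.1 ≠ e.2)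
    (x : (Fin k × Fin n) ⊕ (Fin k × Fin n) → ℝ) (p : Fin n → Fin (2 * k) → ℝ)
    (h1 : ∀ l m, p m (hypIdx k (Sum.inl l)) = x (Sum.inr (l, m)))
    (h2 : ∀ l m, p m (hypIdx k (Sum.inr l)) = - x (Sum.inl (l, m))) :
    (fun s => eval x (pderiv s (skewEntry k n e))) = hypLin k n (hypRow p e) := by
  classical
  obtain ⟨i, j⟩ := e
  ext (⟨l, m⟩ | ⟨l, m⟩)
  · simp only [skewEntry, map_sum, map_sub, pderiv_mul, pderiv_X, hypLin]
    by_cases hi : m = i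
    · subst hi
      have : j ≠ m := fun h => he h.symm
      simp [hypRow, Pi.single_apply, apply_ite (eval x), h1, this, he]
    · by_cases hj : m = j
      · subst hj
        have : i ≠ m := fun h => hi h.symm
        simp [hypRow, Pi.single_apply, apply_ite (eval x), h1, this, hi]
      · have h3 : i ≠ m := fun h => hi h.symm
        have h4 : j ≠ m := fun h => hj h.symm
        simp [hypRow, Pi.single_apply, apply_ite (eval x), h3, h4, hi, hj]
  · simp only [skewEntry, map_sum, map_sub, pderiv_mul, pderiv_X, hypLin]
    by_cases hi : m = i
    · subst hi
      have : j ≠ m := fun h => he h.symm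
      simp [hypRow, Pi.single_apply, apply_ite (eval x), h2, this, he]
    · by_cases hj : m = j
      · subst hj
        have : i ≠ m := fun h => hi h.symm
        simp [hypRow, Pi.single_apply, apply_ite (eval x), h2, this, hi]
      · have h3 : i ≠ m := fun h => hi h.symm
        have h4 : j ≠ m := fun h => hj h.symm
        simp [hypRow, Pi.single_apply, apply_ite (eval x), h3, h4, hi, hj]

/-- For even `d = 2k`, the generic `d`-dimensional hyperconnectivity matroid equals the
algebraic matroid of `n × n` skew-symmetric matrices of rank at most `d`: a set `S` of
pairs is algebraically independent as entries of the parametrization iff it is independent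
in the hyperconnectivity matroid of some (generic) points `p₁, …, pₙ ∈ ℝ^{2k}`. -/
theorem hyperconnectivity_eq_skew_algebraic_matroid
    (k n : ℕ) (hn : 1 ≤ n)
    (S : Set (Fin n × Fin n)) (hS : ∀ e ∈ S, e.1 < e.2) :
    AlgebraicIndependent ℝ (fun e : S => skewEntry k n e.1) ↔
      ∃ p : Fin n → Fin (2 * k) → ℝ,
        LinearIndependent ℝ (fun e : S => hypRow p e.1) := by
  classical
  have : Fintype S := Fintype.ofFinite S
  have key : ∀ (x : (Fin k × Fin n) ⊕ (Fin k × Fin n) → ℝ) (p : Fin n → Fin (2 * k) → ℝ),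
      (∀ l m, p m (hypIdx k (Sum.inl l)) = x (Sum.inr (l, m))) →
      (∀ l m, p m (hypIdx k (Sum.inr l)) = - x (Sum.inl (l, m))) →
      (LinearIndependent ℝ (fun (e : S) s => MvPolynomial.eval x
        (MvPolynomial.pderiv s (skewEntry k n e.1))) ↔
        LinearIndependent ℝ (fun e : S => hypRow p e.1)) := by
    intro x p h1 h2
    have h3 : (fun (e : S) s => MvPolynomial.eval x
        (MvPolynomial.pderiv s (skewEntry k n e.1))) =
        (hypLin k n).toLinearMap ∘ (fun e : S => hypRow p e.1) := by
      funext e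
      exact hyp_jac k n e.1 (hS e.1 e.2).ne x p h1 h2
    rw [h3]
    exact LinearMap.linearIndependent_iff _ (LinearEquiv.ker _)
  constructor
  · intro h
    obtain ⟨x, hx⟩ := hyp_fwd (FractionRing (MvPolynomial ((Fin k × Fin n) ⊕ (Fin k × Fin n)) ℝ)) _ h
    refine ⟨fun m u => Sum.elim (fun l => x (Sum.inr (l, m))) (fun l => - x (Sum.inl (l, m)))
      ((hypIdx k).symm u), (key x _ ?_ ?_).1 hx⟩
    · simp
    · simp
  · rintro ⟨p, hp⟩
    refine hyp_back _ (Sum.elim (fun q => - p q.2 (hypIdx k (Sum.inr q.1)))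
      (fun q => p q.2 (hypIdx k (Sum.inl q.1)))) ((key _ p ?_ ?_).2 hp)
    · simp
    · simp
end

section
/- Let d ≥ 1, let n = n₁ + n₂, and let p_1, …, p_n ∈ ℝ^d be vectors in linear general position (every subset of at most d of them is linearly independent). Let E be the edge set of the complete bipartite graph K_{n₁,n₂} with parts {1,…,n₁} and {n₁+1,…,n}. If min{n₁, n₂} ≤ d, then the rows of the hyperconnectivity matrix H(p) indexed by E are linearly independent; in particular the rank of K_{n₁,n₂} in the hyperconnectivity matroid H_d(p) equals n₁·n₂. -/
/-- For vectors in linear general position, if `min{n₁, n₂} ≤ d` then the complete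
bipartite graph `K_{n₁,n₂}` is independent in the hyperconnectivity matroid; in
particular its rank equals `n₁ · n₂`. -/
theorem completeBipartite_hyperconnectivity_small
    (d n₁ n₂ : ℕ) (hd : 1 ≤ d)
    (p : Fin (n₁ + n₂) → Fin d → ℝ)
    (hgen : ∀ s : Finset (Fin (n₁ + n₂)), s.card ≤ d →
      LinearIndependent ℝ (fun i : s => p i.1))
    (hmin : min n₁ n₂ ≤ d)
    (E : Set (Fin (n₁ + n₂) × Fin (n₁ + n₂)))
    (hEdef : E = {e | (e.1 : ℕ) < n₁ ∧ n₁ ≤ (e.2 : ℕ)}) :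
    LinearIndependent ℝ (fun e : E => hypRow p e.1) ∧
      Module.finrank ℝ ↥(Submodule.span ℝ (hypRow p '' E)) = n₁ * n₂ := by
  let e : Fin n₁ × Fin n₂ → Fin (n₁ + n₂) × Fin (n₁ + n₂) :=
    fun x => (Fin.castAdd n₂ x.1, Fin.natAdd n₁ x.2)
  have he : Function.Injective e := by
    rintro ⟨a, b⟩ ⟨u, v⟩ h
    simp only [e, Prod.mk.injEq, Fin.ext_iff, Fin.val_castAdd, Fin.val_natAdd] at h
    ext <;> simp <;> omega
  have hE : E = Set.range e := by
    rw [hEdef]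
    ext ⟨a, b⟩
    simp only [Set.mem_ofPred_eq, Set.mem_range, Prod.exists, e, Prod.mk.injEq, Fin.ext_iff,
      Fin.val_castAdd, Fin.val_natAdd]
    constructor
    · rintro ⟨h1, h2⟩
      exact ⟨⟨a, h1⟩, ⟨b - n₁, by omega⟩, rfl, by simp; omega⟩
    · rintro ⟨x, y, h1, h2⟩
      omega
  have hsub : ∀ {m : ℕ} (f : Fin m → Fin (n₁ + n₂)), Function.Injective f → m ≤ d →
      LinearIndependent ℝ (fun i => p (f i)) := by
    intro m f hf hm
    have h := hgen (Finset.univ.image f)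
      (by rw [Finset.card_image_of_injective _ hf]; simpa using hm)
    exact h.comp (fun i : Fin m => ⟨f i, by simp⟩) (fun x y hxy => hf (by simpa using hxy))
  have hli : LinearIndependent ℝ (fun x => hypRow p (e x)) := by
    rw [Fintype.linearIndependent_iff]
    rintro g hg ⟨a, b⟩
    rcases min_le_iff.mp hmin with h | h
    · have hl := Fintype.linearIndependent_iff.mp
        (hsub (Fin.castAdd n₂) (Fin.castAdd_injective _ _) h) (fun i => g (i, b)) ?_ a
      · exact hl
      · have h0 := congrFun hg (Fin.natAdd n₁ b)
        rw [Finset.sum_apply, Fintype.sum_prod_type] at h0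
        have key : ∀ x y, (g (x, y) • hypRow p (e (x, y))) (Fin.natAdd n₁ b)
            = if b = y then -(g (x, y) • p (Fin.castAdd n₂ x)) else 0 := by
          intro x y
          have h1 : Fin.natAdd n₁ b ≠ Fin.castAdd n₂ x := by
            simp only [ne_eq, Fin.ext_iff, Fin.val_castAdd, Fin.val_natAdd]; omega
          simp only [Pi.smul_apply, hypRow, e, if_neg h1, Fin.natAdd_inj]
          split_ifs <;> simp
        simp only [key, Finset.sum_ite_eq, Finset.mem_univ, if_true, Finset.sum_neg_distrib,
          Pi.zero_apply, neg_eq_zero] at h0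
        exact h0
    · have hl := Fintype.linearIndependent_iff.mp
        (hsub (Fin.natAdd n₁) (Fin.natAdd_injective _ _) h) (fun i => g (a, i)) ?_ b
      · exact hl
      · have h0 := congrFun hg (Fin.castAdd n₂ a)
        rw [Finset.sum_apply, Fintype.sum_prod_type_right] at h0
        have key : ∀ x y, (g (x, y) • hypRow p (e (x, y))) (Fin.castAdd n₂ a)
            = if a = x then g (x, y) • p (Fin.natAdd n₁ y) else 0 := by
          intro x y
          have h1 : Fin.castAdd n₂ a ≠ Fin.natAdd n₁ y := by
            simp only [ne_eq, Fin.ext_iff, Fin.val_castAdd, Fin.val_natAdd]; omega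
          simp only [Pi.smul_apply, hypRow, e, if_neg h1, Fin.castAdd_inj]
          split_ifs <;> simp
        simp only [key, Finset.sum_ite_eq, Finset.mem_univ, if_true, Pi.zero_apply] at h0
        exact h0
  subst hE
  constructor
  · exact (linearIndependent_equiv (Equiv.ofInjective e he)).mp hli
  · rw [← Set.range_comp]
    have := finrank_span_eq_card hli
    simpa [Function.comp_def] using this
end

section
/- Let d ≥ 1, let n = n₁ + n₂ with min{n₁, n₂} ≥ d, and let p_1, …, p_n ∈ ℝ^d be vectors in linear general position (every subset of at most d of them is linearly independent). Let E be the edge set of the complete bipartite graph K_{n₁,n₂} with parts {1,…,n₁} and {n₁+1,…,n}. Then the dimension of the linear span of the rows of the hyperconnectivity matrix H(p) indexed by E equals d·n − d². -/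
theorem hyp_single_mem_aux {n d : ℕ} (p : Fin n → Fin d → ℝ) (f : Fin d → Fin n)
    (hsp : ⊤ ≤ Submodule.span ℝ (Set.range (fun k => p (f k))))
    (S : Submodule ℝ (Fin n → Fin d → ℝ)) (i : Fin n)
    (h : ∀ k, Pi.single i (p (f k)) ∈ S) (x : Fin d → ℝ) : Pi.single i x ∈ S := by
  have h1 : Submodule.span ℝ (Set.range (fun k => p (f k))) ≤
      S.comap (LinearMap.single ℝ (fun _ : Fin n => Fin d → ℝ) i) := by
    rw [Submodule.span_le]
    rintro _ ⟨k, rfl⟩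
    exact h k
  exact h1 (hsp (Submodule.mem_top : x ∈ ⊤))

theorem hyp_indep_aux {n d : ℕ} (p : Fin n → Fin d → ℝ)
    (hgen : ∀ s : Finset (Fin n), s.card ≤ d → LinearIndependent ℝ (fun i : s => p i.1))
    (f : Fin d → Fin n) (hf : Function.Injective f) :
    LinearIndependent ℝ (fun k => p (f k)) := by
  have h := hgen (Finset.univ.image f) (Finset.card_image_le.trans (by simp))
  exact h.comp (fun k => ⟨f k, by simp⟩) (fun a b hab => hf (by simpa using hab))

theorem hyp_span_aux {n d : ℕ} (p : Fin n → Fin d → ℝ)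
    (hgen : ∀ s : Finset (Fin n), s.card ≤ d → LinearIndependent ℝ (fun i : s => p i.1))
    (f : Fin d → Fin n) (hf : Function.Injective f) :
    ⊤ ≤ Submodule.span ℝ (Set.range (fun k => p (f k))) :=
  ((hyp_indep_aux p hgen f hf).span_eq_top_of_card_eq_finrank' (by simp)).ge

theorem hypRow_eq_single {n d : ℕ} (p : Fin n → Fin d → ℝ) (a b : Fin n) (hab : a ≠ b) :
    hypRow p (a, b) = Pi.single a (p b) - Pi.single b (p a) := by
  funext k
  by_cases h1 : k = a
  · subst h1; simp [hypRow, hab]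
  · by_cases h2 : k = b
    · subst h2; simp [hypRow, h1]
    · simp [hypRow, h1, h2]

/-- One coordinate of the matrix of stress-type functionals vanishing on bipartite rows. -/
def hypPsi {n d : ℕ} (m : ℕ) (p : Fin n → Fin d → ℝ) (c c' : Fin d) :
    (Fin n → Fin d → ℝ) →ₗ[ℝ] ℝ where
  toFun w := ∑ i : Fin n, if (i : ℕ) < m then w i c * p i c' else p i c * w i c'
  map_add' v w := by
    rw [← Finset.sum_add_distrib]
    refine Finset.sum_congr rfl fun i _ => ?_
    split_ifs <;> simp <;> ring
  map_smul' r w := by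
    simp only [RingHom.id_apply, smul_eq_mul]
    rw [Finset.mul_sum]
    refine Finset.sum_congr rfl fun i _ => ?_
    split_ifs <;> simp <;> ring

theorem hypPsi_single {n d : ℕ} (m : ℕ) (p : Fin n → Fin d → ℝ) (c c' : Fin d)
    (i : Fin n) (x : Fin d → ℝ) :
    hypPsi m p c c' (Pi.single i x) = if (i : ℕ) < m then x c * p i c' else p i c * x c' := by
  show (∑ k : Fin n, _) = _
  rw [Finset.sum_eq_single i]
  · simp
  · intro k _ hk
    simp [Pi.single_eq_of_ne hk]
  · simp

/-- Vectors supported on the vertices in the image of `f`. -/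
def hypExt {n d : ℕ} (f : Fin d → Fin n) :
    (Fin d → Fin d → ℝ) →ₗ[ℝ] (Fin n → Fin d → ℝ) :=
  ∑ k, (LinearMap.single ℝ (fun _ : Fin n => Fin d → ℝ) (f k)) ∘ₗ LinearMap.proj k

theorem hypExt_apply {n d : ℕ} (f : Fin d → Fin n) (u : Fin d → Fin d → ℝ) :
    hypExt f u = ∑ k, Pi.single (f k) (u k) := by
  simp [hypExt]

theorem completeBipartite_hyperconnectivity_large
    (d n₁ n₂ : ℕ) (hd : 1 ≤ d)
    (p : Fin (n₁ + n₂) → Fin d → ℝ)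
    (hgen : ∀ s : Finset (Fin (n₁ + n₂)), s.card ≤ d →
      LinearIndependent ℝ (fun i : s => p i.1))
    (hmin : d ≤ min n₁ n₂)
    (E : Set (Fin (n₁ + n₂) × Fin (n₁ + n₂)))
    (hEdef : E = {e | (e.1 : ℕ) < n₁ ∧ n₁ ≤ (e.2 : ℕ)}) :
    Module.finrank ℝ ↥(Submodule.span ℝ (hypRow p '' E)) = d * (n₁ + n₂) - d ^ 2 := by
  have hd1 : d ≤ n₁ := hmin.trans (min_le_left _ _)
  have hd2 : d ≤ n₂ := hmin.trans (min_le_right _ _)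
  let f : Fin d → Fin (n₁ + n₂) := fun k => ⟨k, by omega⟩
  let g : Fin d → Fin (n₁ + n₂) := fun k => ⟨n₁ + k, by omega⟩
  have hf : Function.Injective f := fun a b h => by
    simp only [f, Fin.mk.injEq] at h; exact Fin.ext h
  have hg : Function.Injective g := fun a b h => by
    simp only [g, Fin.mk.injEq] at h; exact Fin.ext (by omega)
  have hfl : ∀ k, (f k : ℕ) < n₁ := fun k => by simp only [f]; omega
  have hgl : ∀ k, n₁ ≤ (g k : ℕ) := fun k => by simp only [g]; omega
  have hli := hyp_indep_aux p hgen f hf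
  set W := Submodule.span ℝ (hypRow p '' E) with hW
  have hrow : ∀ a b : Fin (n₁ + n₂), (a : ℕ) < n₁ → n₁ ≤ (b : ℕ) →
      Pi.single a (p b) - Pi.single b (p a) ∈ W := by
    intro a b ha hb
    rw [← hypRow_eq_single p a b (by rintro rfl; omega)]
    exact Submodule.subset_span ⟨(a, b), by rw [hEdef]; exact ⟨ha, hb⟩, rfl⟩
  have hker : ∀ w ∈ W, ∀ c c', hypPsi n₁ p c c' w = 0 := by
    intro w hw c c'
    have : W ≤ LinearMap.ker (hypPsi n₁ p c c') := by
      rw [hW, Submodule.span_le]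
      rintro _ ⟨⟨a, b⟩, he, rfl⟩
      rw [hEdef] at he
      obtain ⟨ha, hb⟩ := he
      simp only at ha hb
      rw [hypRow_eq_single p a b (by rintro rfl; omega)]
      simp [hypPsi_single, ha, not_lt.2 hb]
    exact this hw
  have hext : ∀ u, (∀ c c', hypPsi n₁ p c c' (hypExt f u) = 0) → u = 0 := by
    intro u hu
    funext k c
    refine Fintype.linearIndependent_iff.1 hli (fun k => u k c) ?_ k
    funext c'
    have := hu c c'
    rw [hypExt_apply, map_sum] at this
    simpa [hypPsi_single, hfl] using this
  have hinj : Function.Injective (hypExt (n := n₁ + n₂) f) := by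
    rw [injective_iff_map_eq_zero]
    intro u hu
    exact hext u (fun c c' => by rw [hu, map_zero])
  have hcompl : IsCompl W (LinearMap.range (hypExt f)) := by
    refine ⟨?_, ?_⟩
    · rw [Submodule.disjoint_def]
      rintro _ hw ⟨u, rfl⟩
      rw [hext u (hker _ hw), map_zero]
    · rw [codisjoint_iff, eq_top_iff]
      set S := W ⊔ LinearMap.range (hypExt f) with hS
      have hWS : W ≤ S := le_sup_left
      have h0 : ∀ k x, Pi.single (f k) x ∈ S := by
        intro k x
        refine (le_sup_right : _ ≤ S) ⟨Pi.single k x, ?_⟩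
        rw [hypExt_apply, Finset.sum_eq_single k]
        · simp
        · intro b _ hb
          simp [Pi.single_eq_of_ne hb]
        · simp
      have hB : ∀ j : Fin (n₁ + n₂), n₁ ≤ (j : ℕ) → ∀ x, Pi.single j x ∈ S := by
        intro j hj x
        refine hyp_single_mem_aux p f (hyp_span_aux p hgen f hf) S j (fun k => ?_) x
        have := S.sub_mem (h0 k (p j)) (hWS (hrow (f k) j (hfl k) hj))
        simpa using this
      have hA : ∀ i : Fin (n₁ + n₂), (i : ℕ) < n₁ → ∀ x, Pi.single i x ∈ S := by
        intro i hi x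
        refine hyp_single_mem_aux p g (hyp_span_aux p hgen g hg) S i (fun k => ?_) x
        have := S.add_mem (hB (g k) (hgl k) (p i)) (hWS (hrow i (g k) hi (hgl k)))
        simpa using this
      intro w _
      rw [← Finset.univ_sum_single w]
      refine S.sum_mem fun i _ => ?_
      rcases lt_or_ge (i : ℕ) n₁ with hi | hi
      · exact hA i hi _
      · exact hB i hi _
  have h1 := Submodule.finrank_add_eq_of_isCompl hcompl
  rw [LinearMap.finrank_range_of_inj hinj] at h1
  simp only [Module.finrank_pi_fintype, Module.finrank_self, Finset.sum_const, Finset.card_univ,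
    Fintype.card_fin, smul_eq_mul, mul_one] at h1
  rw [pow_two, mul_comm d (n₁ + n₂), ← h1, Nat.add_sub_cancel]
end

section
/- Let d ≥ 1, let n = n₁ + n₂, and let p_1, …, p_n ∈ ℝ^d be any vectors. Let E be the edge set of the complete bipartite graph K_{n₁,n₂} with parts {1,…,n₁} and {n₁+1,…,n}, and let d₁ and d₂ be the dimensions of the linear spans of {p_1,…,p_{n₁}} and of {p_{n₁+1},…,p_n}, respectively. Then the dimension of the linear span of the rows of the hyperconnectivity matrix H(p) indexed by E equals n₁·n₂ − (n₁ − d₁)(n₂ − d₂). -/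
/-- The linear map sending a weight matrix on `K_{n₁,n₂}` to the combination of rows. -/
noncomputable def bipMap {n₁ n₂ d : ℕ} (p : Fin (n₁ + n₂) → Fin d → ℝ) :
    (Fin n₁ × Fin n₂ → ℝ) →ₗ[ℝ] (Fin (n₁ + n₂) → Fin d → ℝ) :=
  Fintype.linearCombination ℝ
    (fun e : Fin n₁ × Fin n₂ => hypRow p (Fin.castAdd n₂ e.1, Fin.natAdd n₁ e.2))

theorem castAdd_ne_natAdd_aux {n₁ n₂ : ℕ} (i : Fin n₁) (j : Fin n₂) :
    Fin.castAdd n₂ i ≠ Fin.natAdd n₁ j := by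
  intro h
  have := congrArg Fin.val h
  simp at this
  omega

theorem bipMap_left {n₁ n₂ d : ℕ} (p : Fin (n₁ + n₂) → Fin d → ℝ) (M : Fin n₁ × Fin n₂ → ℝ)
    (i : Fin n₁) :
    bipMap p M (Fin.castAdd n₂ i) = ∑ j, M (i, j) • p (Fin.natAdd n₁ j) := by
  simp only [bipMap, Fintype.linearCombination_apply, Finset.sum_apply, Pi.smul_apply, hypRow,
    Fintype.sum_prod_type, castAdd_ne_natAdd_aux, if_false, Fin.castAdd_inj]
  rw [Finset.sum_eq_single i]
  · simp
  · intro b _ hb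
    simp [hb.symm]
  · simp

theorem bipMap_right {n₁ n₂ d : ℕ} (p : Fin (n₁ + n₂) → Fin d → ℝ) (M : Fin n₁ × Fin n₂ → ℝ)
    (j : Fin n₂) :
    bipMap p M (Fin.natAdd n₁ j) = -∑ i, M (i, j) • p (Fin.castAdd n₂ i) := by
  simp only [bipMap, Fintype.linearCombination_apply, Finset.sum_apply, Pi.smul_apply, hypRow,
    Fintype.sum_prod_type, (castAdd_ne_natAdd_aux _ _).symm, if_false, Fin.natAdd_inj]
  rw [Finset.sum_comm, Finset.sum_eq_single j]
  · simp
  · intro b _ hb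
    simp [hb.symm]
  · simp

theorem bipMap_eq_zero {n₁ n₂ d : ℕ} (p : Fin (n₁ + n₂) → Fin d → ℝ) (M : Fin n₁ × Fin n₂ → ℝ) :
    bipMap p M = 0 ↔ (∀ i, ∑ j, M (i, j) • p (Fin.natAdd n₁ j) = 0) ∧
      (∀ j, ∑ i, M (i, j) • p (Fin.castAdd n₂ i) = 0) := by
  constructor
  · intro h
    refine ⟨fun i => ?_, fun j => ?_⟩
    · rw [← bipMap_left, h]; rfl
    · rw [← neg_eq_zero, ← bipMap_right, h]; rfl
  · rintro ⟨h1, h2⟩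
    funext k
    induction k using Fin.addCases with
    | left i => rw [bipMap_left, h1]; rfl
    | right j => rw [bipMap_right, h2]; simp

theorem finrank_ker_bip {n₁ n₂ d : ℕ} (p : Fin (n₁ + n₂) → Fin d → ℝ)
    (A : Matrix (Fin n₁) (Fin d) ℝ) (B : Fin n₂ → Fin d → ℝ)
    (hA : ∀ i, A i = p (Fin.castAdd n₂ i)) (hB : ∀ j, B j = p (Fin.natAdd n₁ j)) :
    Module.finrank ℝ (LinearMap.ker (bipMap p)) =
      (n₁ - Module.finrank ℝ (Submodule.span ℝ (Set.range A))) *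
      (n₂ - Module.finrank ℝ (Submodule.span ℝ (Set.range B))) := by
  set K := LinearMap.ker (Fintype.linearCombination ℝ B) with hK
  have hKd : Module.finrank ℝ K =
      n₂ - Module.finrank ℝ (Submodule.span ℝ (Set.range B)) := by
    have := LinearMap.finrank_range_add_finrank_ker (Fintype.linearCombination ℝ B)
    rw [Fintype.range_linearCombination, ← hK, Module.finrank_fintype_fun_eq_card,
      Fintype.card_fin] at this
    omega
  set R := Submodule.span ℝ (Set.range A.col) with hR
  have hRd : Module.finrank ℝ ((Fin n₁ → ℝ) ⧸ R) =
      n₁ - Module.finrank ℝ (Submodule.span ℝ (Set.range A)) := by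
    have h1 := Submodule.finrank_quotient_add_finrank R
    have h2 : Module.finrank ℝ R = Module.finrank ℝ (Submodule.span ℝ (Set.range A)) :=
      (Matrix.rank_eq_finrank_span_cols A).symm.trans (Matrix.rank_eq_finrank_span_row A)
    simp at h1
    omega
  let Ψ : (((Fin n₁ → ℝ) ⧸ R) →ₗ[ℝ] K) →ₗ[ℝ] (Fin n₁ × Fin n₂ → ℝ) :=
    { toFun := fun f e => (f (R.mkQ (Pi.single e.1 1))).1 e.2
      map_add' := fun f g => by ext e; simp
      map_smul' := fun c f => by ext e; simp }
  have hΨ : ∀ f e, Ψ f e = (f (R.mkQ (Pi.single e.1 1))).1 e.2 := fun _ _ => rfl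
  have hinj : Function.Injective Ψ := by
    intro f g h
    apply Submodule.linearMap_qext
    apply (Pi.basisFun ℝ (Fin n₁)).ext
    intro i
    apply Subtype.ext
    funext j
    have := congrFun h (i, j)
    simpa [hΨ] using this
  have hrange : LinearMap.range Ψ = LinearMap.ker (bipMap p) := by
    ext M
    rw [LinearMap.mem_ker, bipMap_eq_zero, LinearMap.mem_range]
    constructor
    · rintro ⟨f, rfl⟩
      refine ⟨fun i => ?_, fun j => ?_⟩
      · have : Fintype.linearCombination ℝ B (f (R.mkQ (Pi.single i 1))).1 = 0 :=
          (f (R.mkQ (Pi.single i 1))).2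
        rw [Fintype.linearCombination_apply] at this
        simpa [hΨ, hB] using this
      · funext a
        have h0 : R.mkQ (A.col a) = 0 := by
          rw [Submodule.mkQ_apply, Submodule.Quotient.mk_eq_zero]
          exact Submodule.subset_span ⟨a, rfl⟩
        have h1 : A.col a = ∑ i, A i a • (Pi.single i (1:ℝ) : Fin n₁ → ℝ) := by
          conv_lhs => rw [pi_eq_sum_univ' (A.col a)]
          simp only [← Pi.single_apply, Matrix.col_apply]
        have h2 := congrArg (fun v => (f v).1 j) h0
        rw [h1] at h2
        simp only [map_sum, map_smul, map_zero] at h2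
        simp only [Submodule.coe_sum, Submodule.coe_smul, Finset.sum_apply, Pi.smul_apply,
          smul_eq_mul, Submodule.coe_zero, Pi.zero_apply] at h2
        simp only [Finset.sum_apply, Pi.smul_apply, smul_eq_mul, Pi.zero_apply, hΨ, ← hA]
        rw [← h2]
        exact Finset.sum_congr rfl fun i _ => mul_comm _ _
    · rintro ⟨h1, h2⟩
      let r : Fin n₁ → K := fun i => ⟨fun j => M (i, j), by
        rw [hK, LinearMap.mem_ker, Fintype.linearCombination_apply]
        simpa [hB] using h1 i⟩
      refine ⟨R.liftQ (Fintype.linearCombination ℝ r) ?_, ?_⟩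
      · rw [hR, Submodule.span_le]
        rintro _ ⟨a, rfl⟩
        rw [SetLike.mem_coe, LinearMap.mem_ker, Fintype.linearCombination_apply]
        apply Subtype.ext
        funext j
        have := congrFun (h2 j) a
        simp only [Submodule.coe_sum, Submodule.coe_smul, Finset.sum_apply, Pi.smul_apply,
          smul_eq_mul, Submodule.coe_zero, Pi.zero_apply, ← hA] at this ⊢
        rw [← this]
        exact Finset.sum_congr rfl fun i _ => mul_comm _ _
      · funext e
        rw [hΨ, Submodule.mkQ_apply, Submodule.liftQ_apply,
          Fintype.linearCombination_apply_single]
        simp [r]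
  rw [← hrange, LinearMap.finrank_range_of_inj hinj, Module.finrank_linearMap, hKd, hRd]

/-- For arbitrary vectors `p₁, …, pₙ ∈ ℝ^d`, the rank of the complete bipartite graph
`K_{n₁,n₂}` in the hyperconnectivity matroid equals `n₁·n₂ − (n₁ − d₁)(n₂ − d₂)`, where
`d₁` and `d₂` are the dimensions of the linear spans of the two parts. -/
theorem completeBipartite_hyperconnectivity_rank
    (d n₁ n₂ : ℕ) (hd : 1 ≤ d)
    (p : Fin (n₁ + n₂) → Fin d → ℝ)
    (E : Set (Fin (n₁ + n₂) × Fin (n₁ + n₂)))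
    (hEdef : E = {e | (e.1 : ℕ) < n₁ ∧ n₁ ≤ (e.2 : ℕ)})
    (d₁ d₂ : ℕ)
    (hd₁ : d₁ = Module.finrank ℝ
      ↥(Submodule.span ℝ (p '' {i | (i : ℕ) < n₁})))
    (hd₂ : d₂ = Module.finrank ℝ
      ↥(Submodule.span ℝ (p '' {i | n₁ ≤ (i : ℕ)}))) :
    Module.finrank ℝ ↥(Submodule.span ℝ (hypRow p '' E)) =
      n₁ * n₂ - (n₁ - d₁) * (n₂ - d₂) := by
  have h1 : p '' {i | (i : ℕ) < n₁} = Set.range (fun i => p (Fin.castAdd n₂ i)) := by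
    ext v
    constructor
    · rintro ⟨i, hi, rfl⟩
      exact ⟨⟨i, hi⟩, rfl⟩
    · rintro ⟨i, rfl⟩
      exact ⟨_, by simp, rfl⟩
  have h2 : p '' {i | n₁ ≤ (i : ℕ)} = Set.range (fun j => p (Fin.natAdd n₁ j)) := by
    ext v
    constructor
    · rintro ⟨i, hi, rfl⟩
      induction i using Fin.addCases with
      | left i => simp at hi; omega
      | right j => exact ⟨j, rfl⟩
    · rintro ⟨i, rfl⟩
      exact ⟨_, by simp, rfl⟩
  have h3 : hypRow p '' E = Set.range (fun e : Fin n₁ × Fin n₂ =>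
      hypRow p (Fin.castAdd n₂ e.1, Fin.natAdd n₁ e.2)) := by
    subst hEdef
    ext v
    constructor
    · rintro ⟨⟨i, j⟩, ⟨hi, hj⟩, rfl⟩
      induction j using Fin.addCases with
      | left j => simp at hj; omega
      | right j => exact ⟨(⟨i, hi⟩, j), rfl⟩
    · rintro ⟨⟨i, j⟩, rfl⟩
      exact ⟨_, by simp, rfl⟩
  have hk := finrank_ker_bip p (fun i => p (Fin.castAdd n₂ i)) (fun j => p (Fin.natAdd n₁ j))
    (fun _ => rfl) (fun _ => rfl)
  have hr := LinearMap.finrank_range_add_finrank_ker (bipMap p)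
  rw [h1] at hd₁
  rw [h2] at hd₂
  rw [hk, ← hd₁, ← hd₂, bipMap, Fintype.range_linearCombination] at hr
  rw [h3]
  simp only [Module.finrank_fintype_fun_eq_card, Fintype.card_prod, Fintype.card_fin] at hr
  exact Nat.eq_sub_of_add_eq hr
end

section
/- Let d ≥ 1, let n = 2d + 2, and let p_1, …, p_n ∈ ℝ^d be vectors in linear general position (every subset of at most d of them is linearly independent). Let E be the edge set of the complete bipartite graph K_{d+1,d+1} with parts {1,…,d+1} and {d+2,…,2d+2}. Then E is a circuit of the hyperconnectivity matroid H_d(p): the rows of the hyperconnectivity matrix H(p) indexed by E are linearly dependent, but for every proper subset E' ⊊ E the rows indexed by E' are linearly independent. -/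
lemma hyp_unique {d : ℕ} {ι : Type*} [Fintype ι] [DecidableEq ι]
    (p : ι → Fin d → ℝ)
    (hgen : ∀ s : Finset ι, s.card ≤ d → LinearIndependent ℝ (fun i : s => p i.1))
    (S : Finset ι) (hS : S.card = d + 1) (c : ι → ℝ) (hc : ∀ i, i ∉ S → c i = 0)
    (hsum : ∑ i, c i • p i = 0) (i0 : ι) (hi0 : i0 ∈ S) (h0 : c i0 = 0) : ∀ i, c i = 0 := by
  have hcard : (S.erase i0).card ≤ d := by
    rw [Finset.card_erase_of_mem hi0, hS]; simp
  have hz : ∀ i, i ∉ S.erase i0 → c i = 0 := by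
    intro i hi
    by_cases h : i = i0
    · rw [h, h0]
    · exact hc i (fun h' => hi (Finset.mem_erase.2 ⟨h, h'⟩))
  have hli := hgen _ hcard
  rw [Fintype.linearIndependent_iff] at hli
  have hs : ∑ i : (S.erase i0 : Finset ι), c i.1 • p i.1 = 0 := by
    rw [Finset.sum_coe_sort (S.erase i0) (fun i => c i • p i), ← hsum]
    exact Finset.sum_subset (Finset.subset_univ _) (fun i _ hi => by rw [hz i hi, zero_smul])
  intro i
  by_cases hi : i ∈ S.erase i0
  · exact hli (fun i => c i.1) hs ⟨i, hi⟩
  · exact hz i hi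

lemma hyp_exists {d : ℕ} {ι : Type*} [Fintype ι] [DecidableEq ι]
    (p : ι → Fin d → ℝ) (S : Finset ι) (hS : S.card = d + 1) :
    ∃ c : ι → ℝ, (∀ i, i ∉ S → c i = 0) ∧ ∑ i, c i • p i = 0 ∧ ∃ i ∈ S, c i ≠ 0 := by
  have h : ¬ LinearIndependent ℝ (fun i : S => p i.1) := by
    intro h
    have := h.fintype_card_le_finrank
    simp [hS] at this
  rw [Fintype.not_linearIndependent_iff] at h
  obtain ⟨g, hg, ⟨i, hi⟩, hne⟩ := h
  refine ⟨fun i => if h : i ∈ S then g ⟨i, h⟩ else 0, fun i hi => by simp [hi], ?_, i, hi, ?_⟩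
  · rw [← hg, ← Finset.sum_subset (Finset.subset_univ S)
      (fun i _ hi => by simp [hi]), ← Finset.sum_coe_sort S]
    exact Finset.sum_congr rfl (fun i _ => by simp)
  · simpa [hi] using hne

lemma hyp_sum {n d : ℕ} (p : Fin n → Fin d → ℝ) (w : Fin n × Fin n → ℝ)
    (hw : ∀ i, w (i, i) = 0) (k : Fin n) :
    (∑ e, w e • hypRow p e) k = ∑ j, w (k, j) • p j - ∑ i, w (i, k) • p i := by
  have key : ∀ i j, w (i, j) • hypRow p (i, j) k
      = (if k = i then w (i, j) • p j else 0) - (if k = j then w (i, j) • p i else 0) := by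
    intro i j
    unfold hypRow
    by_cases h1 : k = i <;> by_cases h2 : k = j
    · subst h1; subst h2; simp [hw]
    · subst h1; simp [h2]
    · subst h2; simp [h1]
    · simp [h1, h2]
  rw [Finset.sum_apply, Fintype.sum_prod_type]
  simp only [Pi.smul_apply, key, Finset.sum_sub_distrib]
  congr 1
  · rw [Finset.sum_comm]; simp
  · simp

/-- For `n = 2d + 2` vectors in linear general position, the complete bipartite graph
`K_{d+1,d+1}` is a circuit of the hyperconnectivity matroid: its rows are linearly
dependent, but the rows of every proper subset are linearly independent. -/
theorem completeBipartite_circuit_hyperconnectivity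
    (d : ℕ) (hd : 1 ≤ d)
    (p : Fin (2 * d + 2) → Fin d → ℝ)
    (hgen : ∀ s : Finset (Fin (2 * d + 2)), s.card ≤ d →
      LinearIndependent ℝ (fun i : s => p i.1))
    (E : Set (Fin (2 * d + 2) × Fin (2 * d + 2)))
    (hEdef : E = {e | (e.1 : ℕ) < d + 1 ∧ d + 1 ≤ (e.2 : ℕ)}) :
    ¬ LinearIndependent ℝ (fun e : E => hypRow p e.1) ∧
      ∀ E' ⊂ E, LinearIndependent ℝ (fun e : E' => hypRow p e.1) := by
  classical
  let A : Finset (Fin (2 * d + 2)) := Finset.univ.filter (fun i => (i : ℕ) < d + 1)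
  let B : Finset (Fin (2 * d + 2)) := Aᶜ
  have hA : A.card = d + 1 := by
    have : A = Finset.Iio (⟨d + 1, by omega⟩ : Fin (2 * d + 2)) := by
      ext i; simp [A, Fin.lt_def]
    rw [this, Fin.card_Iio]
  have hB : B.card = d + 1 := by
    rw [Finset.card_compl, hA, Fintype.card_fin]; omega
  have hE : ∀ i j, (i, j) ∈ E ↔ i ∈ A ∧ j ∈ B := by
    intro i j; simp [hEdef, A, B]
  constructor
  · intro hli
    obtain ⟨a, ha, hsa, i, hi, hai⟩ := hyp_exists p A hA
    obtain ⟨b, hb, hsb, j, hj, hbj⟩ := hyp_exists p B hB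
    let w : Fin (2 * d + 2) × Fin (2 * d + 2) → ℝ := fun e => a e.1 * b e.2
    have hw : ∀ i, w (i, i) = 0 := by
      intro i
      by_cases h : i ∈ A
      · simp [w, hb i (by simp [B, h])]
      · simp [w, ha i h]
    have hwE : ∀ e, e ∉ E → w e = 0 := by
      rintro ⟨i, j⟩ h
      rw [hE] at h
      by_cases h1 : i ∈ A
      · simp [w, hb j (fun h2 => h ⟨h1, h2⟩)]
      · simp [w, ha i h1]
    have hs : ∑ e, w e • hypRow p e = 0 := by
      funext k
      rw [hyp_sum p w hw k]
      have h1 : ∑ j, w (k, j) • p j = 0 := by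
        simp only [w, mul_smul, ← Finset.smul_sum, hsb, smul_zero]
      have h2 : ∑ i, w (i, k) • p i = 0 := by
        simp only [w, mul_comm (a _), mul_smul, ← Finset.smul_sum, hsa, smul_zero]
      rw [h1, h2]; simp
    rw [Fintype.linearIndependent_iff] at hli
    have := hli (fun e => w e.1) (by
      rw [← hs, ← Finset.sum_subset (Finset.subset_univ E.toFinset)
        (fun e _ he => by rw [hwE e (by simpa using he), zero_smul])]
      exact (Finset.sum_subtype E.toFinset (by simp) (fun e => w e • hypRow p e)).symm)
      ⟨(i, j), (hE i j).2 ⟨hi, hj⟩⟩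
    exact mul_ne_zero hai hbj this
  · intro E' hE'
    obtain ⟨hsub, ⟨i0, j0⟩, h0E, h0⟩ := Set.ssubset_iff_exists.1 hE'
    rw [hE] at h0E
    rw [Fintype.linearIndependent_iff]
    intro g hg
    let w : Fin (2 * d + 2) × Fin (2 * d + 2) → ℝ := fun e => if h : e ∈ E' then g ⟨e, h⟩ else 0
    have hwE' : ∀ e, e ∉ E' → w e = 0 := fun e h => by simp [w, h]
    have hwA : ∀ i j, i ∉ A → w (i, j) = 0 := fun i j h =>
      hwE' _ (fun h' => h ((hE i j).1 (hsub h')).1)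
    have hwB : ∀ i j, j ∉ B → w (i, j) = 0 := fun i j h =>
      hwE' _ (fun h' => h ((hE i j).1 (hsub h')).2)
    have hw : ∀ i, w (i, i) = 0 := by
      intro i
      by_cases h : i ∈ A
      · exact hwB i i (by simp [B, h])
      · exact hwA i i h
    have hs : ∑ e, w e • hypRow p e = 0 := by
      rw [← hg, ← Finset.sum_subset (Finset.subset_univ E'.toFinset)
        (fun e _ he => by rw [hwE' e (by simpa using he), zero_smul]),
        Finset.sum_subtype E'.toFinset (p := (· ∈ E')) (by simp) (fun e => w e • hypRow p e)]
      exact Finset.sum_congr rfl (fun e _ => by simp [w])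
    have hk : ∀ k, ∑ j, w (k, j) • p j - ∑ i, w (i, k) • p i = 0 := fun k => by
      rw [← hyp_sum p w hw k, hs]; rfl
    have hrow : ∀ j, w (i0, j) = 0 := by
      refine hyp_unique p hgen B hB (fun j => w (i0, j)) (fun j h => hwB i0 j h) ?_ j0 h0E.2
        (hwE' _ h0)
      have := hk i0
      rwa [Finset.sum_eq_zero (s := Finset.univ) (f := fun i => w (i, i0) • p i)
        (fun i _ => by rw [hwB i i0 (by simp [B, h0E.1]), zero_smul]), sub_zero] at this
    have hcol : ∀ j, j ∈ B → ∀ i, w (i, j) = 0 := by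
      intro j hj
      refine hyp_unique p hgen A hA (fun i => w (i, j)) (fun i h => hwA i j h) ?_ i0 h0E.1
        (hrow j)
      have := hk j
      rwa [Finset.sum_eq_zero (s := Finset.univ) (f := fun i => w (j, i) • p i)
        (fun i _ => by rw [hwA j i (by simpa [B] using hj), zero_smul]), zero_sub,
        neg_eq_zero] at this
    rintro ⟨⟨i, j⟩, he⟩
    have := hcol j ((hE i j).1 (hsub he)).2 i
    simpa [w, he] using this
end

section
/- Let G = (V, E) be a graph, v ∈ V a vertex whose neighborhood is partitioned into three parts A, B, C with |B| = d − 1, and let G' = (V ∪ {v'}, E') be the vertex d-split of G at v: E' is obtained from E by removing all edges {v, w} with w ∈ C and adding a new vertex v' with edges {v', w} for every w ∈ B ∪ C and the edge {v, v'}. Let p : V → ℝ^d be positions such that the d vectors {p_v} ∪ {p_u : u ∈ B} form a basis of ℝ^d, and let p' : V ∪ {v'} → ℝ^d extend p by p'_{v'} = p_v. Then the corank of E with respect to the hyperconnectivity matrix H(p) equals the corank of E' with respect to H(p'): |E| minus the dimension of the span of the rows of H(p) indexed by E equals |E'| minus the dimension of the span of the rows of H(p') indexed by E'. In particular, if the rows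 of H(p) indexed by E are linearly independent, then the rows of H(p') indexed by E' are linearly independent. -/
/-- Folding the last block onto block `v`. -/
def foldMap {m d : ℕ} (v : Fin m) :
    (Fin (m + 1) → Fin d → ℝ) →ₗ[ℝ] (Fin m → Fin d → ℝ) where
  toFun x := fun k => x (Fin.castSucc k) + if k = v then x (Fin.last m) else 0
  map_add' x y := by
    ext k i
    by_cases h : k = v <;> simp [h] <;> ring
  map_smul' c x := by
    ext k i
    by_cases h : k = v <;> simp [h] <;> ring

/-- The vector `y` in block `v`, and `-y` in the last block. -/
def foldKer {m d : ℕ} (v : Fin m) :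
    (Fin d → ℝ) →ₗ[ℝ] (Fin (m + 1) → Fin d → ℝ) where
  toFun y := fun k => if k = Fin.castSucc v then y else if k = Fin.last m then -y else 0
  map_add' x y := by
    ext k i
    simp only [Pi.add_apply]
    split_ifs <;> simp <;> ring
  map_smul' c x := by
    ext k i
    simp only [Pi.smul_apply, RingHom.id_apply]
    split_ifs <;> simp

theorem foldMap_surjective {m d : ℕ} (v : Fin m) :
    Function.Surjective (foldMap (d := d) v) := by
  intro y
  refine ⟨Fin.snoc y 0, ?_⟩
  ext k i
  simp [foldMap]

theorem finrank_ker_foldMap {m d : ℕ} (v : Fin m) :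
    Module.finrank ℝ (LinearMap.ker (foldMap (d := d) v)) = d := by
  have h := LinearMap.finrank_range_add_finrank_ker (foldMap (d := d) v)
  rw [LinearMap.range_eq_top.2 (foldMap_surjective v), finrank_top] at h
  simp only [Module.finrank_pi_fintype, Module.finrank_self, Finset.sum_const, Finset.card_univ,
    Fintype.card_fin, smul_eq_mul, mul_one] at h
  rw [Nat.add_mul] at h
  omega

theorem ker_foldMap_eq {m d : ℕ} (v : Fin m) (x : Fin (m + 1) → Fin d → ℝ)
    (hx : x ∈ LinearMap.ker (foldMap v)) : x = foldKer v (- x (Fin.last m)) := by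
  have hx' : ∀ k, x (Fin.castSucc k) + (if k = v then x (Fin.last m) else 0) = 0 := by
    intro k
    exact congrFun (LinearMap.mem_ker.1 hx) k
  funext k
  refine Fin.lastCases ?_ (fun k => ?_) k
  · have : Fin.last m ≠ Fin.castSucc v := (Fin.castSucc_lt_last v).ne'
    simp [foldKer, this]
  · have h := hx' k
    have h1 : Fin.castSucc k ≠ Fin.last m := (Fin.castSucc_lt_last k).ne
    by_cases hk : k = v
    · subst hk
      simp at h
      simpa [foldKer] using eq_neg_of_add_eq_zero_left h
    · simp [hk] at h
      simp [foldKer, hk, h1, h]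

theorem hypRow_swap {n d : ℕ} (p : Fin n → Fin d → ℝ) (i j : Fin n) (h : i ≠ j) :
    hypRow p (j, i) = - hypRow p (i, j) := by
  funext k
  by_cases h1 : k = i
  · subst h1
    simp [hypRow, h]
  · by_cases h2 : k = j
    · subst h2
      simp [hypRow, h1]
    · simp [hypRow, h1, h2]

theorem foldMap_castSucc {m d : ℕ} (v : Fin m) (p : Fin m → Fin d → ℝ) (i j : Fin m) :
    foldMap v (hypRow (Fin.snoc p (p v) : Fin (m + 1) → Fin d → ℝ)
      (Fin.castSucc i, Fin.castSucc j)) = hypRow p (i, j) := by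
  funext k
  have h1 : ∀ k : Fin m, Fin.last m ≠ Fin.castSucc k := fun k => (Fin.castSucc_lt_last k).ne'
  simp [foldMap, hypRow, h1]

theorem foldMap_last {m d : ℕ} (v : Fin m) (p : Fin m → Fin d → ℝ) (w : Fin m) (hw : w ≠ v) :
    foldMap v (hypRow (Fin.snoc p (p v) : Fin (m + 1) → Fin d → ℝ)
      (Fin.castSucc w, Fin.last m)) = hypRow p (w, v) := by
  funext k
  have h1 : ∀ k : Fin m, Fin.last m ≠ Fin.castSucc k := fun k => (Fin.castSucc_lt_last k).ne'
  have h2 : ∀ k : Fin m, Fin.castSucc k ≠ Fin.last m := fun k => (Fin.castSucc_lt_last k).ne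
  by_cases h : k = w
  · subst h
    simp [foldMap, hypRow, hw]
  · simp [foldMap, hypRow, h1, h2, h]

theorem hypRow_last_self {m d : ℕ} (v : Fin m) (p : Fin m → Fin d → ℝ) :
    hypRow (Fin.snoc p (p v) : Fin (m + 1) → Fin d → ℝ)
      (Fin.castSucc v, Fin.last m) = foldKer v (p v) := by
  funext k
  simp [foldKer, hypRow]

theorem foldMap_foldKer {m d : ℕ} (v : Fin m) (y : Fin d → ℝ) :
    foldMap v (foldKer v y) = 0 := by
  funext k
  have h1 : ∀ k : Fin m, Fin.last m ≠ Fin.castSucc k := fun k => (Fin.castSucc_lt_last k).ne'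
  have h2 : ∀ k : Fin m, Fin.castSucc k ≠ Fin.last m := fun k => (Fin.castSucc_lt_last k).ne
  by_cases h : k = v <;> simp [foldMap, foldKer, h1, h2, h]

theorem foldKer_eq_sub {m d : ℕ} (v : Fin m) (p : Fin m → Fin d → ℝ) (w : Fin m) (hw : w ≠ v) :
    foldKer v (p w) = hypRow (Fin.snoc p (p v) : Fin (m + 1) → Fin d → ℝ)
      (Fin.castSucc w, Fin.last m) - hypRow (Fin.snoc p (p v) : Fin (m + 1) → Fin d → ℝ)
      (Fin.castSucc w, Fin.castSucc v) := by
  funext k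
  have h1 : ∀ k : Fin m, Fin.last m ≠ Fin.castSucc k := fun k => (Fin.castSucc_lt_last k).ne'
  have h2 : ∀ k : Fin m, Fin.castSucc k ≠ Fin.last m := fun k => (Fin.castSucc_lt_last k).ne
  refine Fin.lastCases ?_ (fun k => ?_) k
  · simp [foldKer, hypRow, h1]
  · by_cases h : k = w
    · subst h
      simp [foldKer, hypRow, hw, h2]
    · by_cases h' : k = v <;> simp [foldKer, hypRow, h, h', h2, hw.symm]

/-- Vertex `d`-split: let `v` be a vertex whose neighborhood is partitioned into `A`,
`B`, `C` with `|B| = d - 1`, and let `G'` (on the vertex set enlarged by the new vertex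
`v' = Fin.last m`) be obtained by removing the edges from `v` to `C` and joining `v'` to
`B ∪ C ∪ {v}`.  If `p_v` together with `{p_u : u ∈ B}` is a basis of `ℝ^d`, and `v'` is
placed at `p_v`, then the corank of `E` in the hyperconnectivity matroid of `p` equals
the corank of `E'` in that of `p'`; in particular a vertex split of an independent graph
is independent. -/
theorem vertexSplit_corank_hyperconnectivity
    (d m : ℕ) (hd : 1 ≤ d) (v : Fin m)
    (E : Finset (Fin m × Fin m)) (hE : ∀ e ∈ E, e.1 < e.2)
    (A B C : Finset (Fin m))
    (hnbhd : ∀ w : Fin m, (w ∈ A ∪ B ∪ C) ↔ ((v, w) ∈ E ∨ (w, v) ∈ E))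
    (hAB : Disjoint A B) (hAC : Disjoint A C) (hBC : Disjoint B C)
    (hBcard : B.card = d - 1)
    (p : Fin m → Fin d → ℝ)
    (hbasis_indep : LinearIndependent ℝ (fun u : ↥(insert v B) => p u.1))
    (hbasis_span : Submodule.span ℝ (p '' ↑(insert v B)) = ⊤)
    (p' : Fin (m + 1) → Fin d → ℝ) (hp' : p' = Fin.snoc p (p v))
    (E' : Finset (Fin (m + 1) × Fin (m + 1)))
    (hE' : E' =
      ((E.filter (fun e => ¬(e.1 = v ∧ e.2 ∈ C) ∧ ¬(e.2 = v ∧ e.1 ∈ C))).image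
          (fun e => (Fin.castSucc e.1, Fin.castSucc e.2)))
        ∪ ((B ∪ C).image (fun w => (Fin.castSucc w, Fin.last m)))
        ∪ {(Fin.castSucc v, Fin.last m)}) :
    (E.card - Module.finrank ℝ
        ↥(Submodule.span ℝ (hypRow p '' (E : Set (Fin m × Fin m)))) =
      E'.card - Module.finrank ℝ
        ↥(Submodule.span ℝ (hypRow p' '' (E' : Set (Fin (m + 1) × Fin (m + 1)))))) ∧
    (LinearIndependent ℝ (fun e : ↥(E : Set (Fin m × Fin m)) => hypRow p e.1) →
      LinearIndependent ℝ
        (fun e : ↥(E' : Set (Fin (m + 1) × Fin (m + 1))) => hypRow p' e.1)) := by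
  subst hp'
  have hself : ∀ w, (v, w) ∈ E ∨ (w, v) ∈ E → w ≠ v := by
    rintro w (h | h) rfl
    · exact lt_irrefl _ (hE _ h)
    · exact lt_irrefl _ (hE _ h)
  have hBv : ∀ w ∈ B, w ≠ v := fun w hw => hself w ((hnbhd w).1 (by simp [hw]))
  have hCv : ∀ w ∈ C, w ≠ v := fun w hw => hself w ((hnbhd w).1 (by simp [hw]))
  have hmem1 : ∀ i j, (i, j) ∈ E → ¬(i = v ∧ j ∈ C) → ¬(j = v ∧ i ∈ C) →
      (Fin.castSucc i, Fin.castSucc j) ∈ E' := by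
    intro i j h h1 h2
    rw [hE']
    refine Finset.mem_union_left _ (Finset.mem_union_left _ ?_)
    exact Finset.mem_image.2 ⟨(i, j), Finset.mem_filter.2 ⟨h, h1, h2⟩, rfl⟩
  have hmem2 : ∀ w ∈ B ∪ C, (Fin.castSucc w, Fin.last m) ∈ E' := by
    intro w h
    rw [hE']
    exact Finset.mem_union_left _ (Finset.mem_union_right _ (Finset.mem_image.2 ⟨w, h, rfl⟩))
  have hmem3 : (Fin.castSucc v, Fin.last m) ∈ E' := by
    rw [hE']
    exact Finset.mem_union_right _ (Finset.mem_singleton_self _)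
  have hcard : E'.card = E.card + d := by
    have hC : (E.filter (fun e => ¬(¬(e.1 = v ∧ e.2 ∈ C) ∧ ¬(e.2 = v ∧ e.1 ∈ C)))).card
        = C.card := by
      symm
      refine Finset.card_bij (fun w _ => if (v, w) ∈ E then (v, w) else (w, v)) ?_ ?_ ?_
      · intro w hw
        have h := (hnbhd w).1 (by simp [hw])
        by_cases h1 : (v, w) ∈ E
        · simp [h1, hw]
        · have h2 := h.resolve_left h1
          simp [h1, h2, hw]
      · intro a ha b hb hab
        have := hCv a ha
        have := hCv b hb
        split_ifs at hab <;> simp only [Prod.mk.injEq] at hab <;> grind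
      · rintro ⟨i, j⟩ hij
        rw [Finset.mem_filter] at hij
        obtain ⟨h1, h2⟩ := hij
        dsimp only at h2
        by_cases h3 : i = v ∧ j ∈ C
        · obtain ⟨rfl, h3⟩ := h3
          exact ⟨j, h3, by simp [h1]⟩
        · have h4 : j = v ∧ i ∈ C := by tauto
          obtain ⟨rfl, h4⟩ := h4
          refine ⟨i, h4, ?_⟩
          have h5 : (j, i) ∉ E := fun h => lt_asymm (hE _ h) (hE _ h1)
          simp [h5]
    have hsum := Finset.card_filter_add_card_filter_not (s := E)
      (fun e => ¬(e.1 = v ∧ e.2 ∈ C) ∧ ¬(e.2 = v ∧ e.1 ∈ C))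
    rw [hC] at hsum
    rw [hE', Finset.card_union_of_disjoint, Finset.card_union_of_disjoint,
      Finset.card_image_of_injective, Finset.card_image_of_injective,
      Finset.card_union_of_disjoint hBC, Finset.card_singleton]
    · omega
    · intro a b h
      simpa using h
    · rintro ⟨a, a2⟩ ⟨b, b2⟩ h
      simpa using h
    · rw [Finset.disjoint_left]
      rintro x hx hx'
      obtain ⟨e, _, rfl⟩ := Finset.mem_image.1 hx
      obtain ⟨w, _, hw⟩ := Finset.mem_image.1 hx'
      exact (Fin.castSucc_lt_last e.2).ne' (congrArg Prod.snd hw)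
    · rw [Finset.disjoint_singleton_right, Finset.mem_union]
      rintro (hx | hx)
      · obtain ⟨e, _, he⟩ := Finset.mem_image.1 hx
        exact (Fin.castSucc_lt_last e.2).ne (congrArg Prod.snd he)
      · obtain ⟨w, hw, he⟩ := Finset.mem_image.1 hx
        have hwv : w = v := Fin.castSucc_injective m (congrArg Prod.fst he)
        rcases Finset.mem_union.1 hw with h | h
        · exact hBv w h hwv
        · exact hCv w h hwv
  set q : Fin (m + 1) → Fin d → ℝ := Fin.snoc p (p v) with hq
  set S := Submodule.span ℝ (hypRow p '' (E : Set (Fin m × Fin m))) with hS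
  set S' := Submodule.span ℝ (hypRow q '' (E' : Set (Fin (m + 1) × Fin (m + 1)))) with hS'
  have memS : ∀ e ∈ E, hypRow p e ∈ S := fun e he =>
    Submodule.subset_span ⟨e, he, rfl⟩
  have memS' : ∀ e ∈ E', hypRow q e ∈ S' := fun e he =>
    Submodule.subset_span ⟨e, he, rfl⟩
  have hker : LinearMap.ker (foldMap v) ≤ S' := by
    have htop : (⊤ : Submodule ℝ (Fin d → ℝ)) ≤ S'.comap (foldKer v) := by
      rw [← hbasis_span, Submodule.span_le]
      rintro _ ⟨w, hw, rfl⟩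
      rw [SetLike.mem_coe, Submodule.mem_comap]
      rcases Finset.mem_insert.1 (Finset.mem_coe.1 hw) with rfl | hw
      · rw [← hypRow_last_self]
        exact memS' _ hmem3
      · rw [foldKer_eq_sub v p w (hBv w hw)]
        refine S'.sub_mem (memS' _ (hmem2 w (by simp [hw]))) ?_
        have hwC : w ∉ C := fun h => Finset.disjoint_left.1 hBC hw h
        have hvC : v ∉ C := fun h => hCv v h rfl
        rcases (hnbhd w).1 (by simp [hw]) with h | h
        · rw [hypRow_swap _ (Fin.castSucc v) (Fin.castSucc w)
            (fun h => hBv w hw (Fin.castSucc_injective m h).symm)]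
          exact S'.neg_mem (memS' _ (hmem1 v w h (by tauto) (by tauto)))
        · exact memS' _ (hmem1 w v h (by tauto) (by tauto))
    intro x hx
    rw [ker_foldMap_eq v x hx]
    exact htop Submodule.mem_top
  have hmap : S'.map (foldMap v) = S := by
    apply le_antisymm
    · rw [Submodule.map_le_iff_le_comap, hS', Submodule.span_le]
      rintro _ ⟨e, he, rfl⟩
      rw [SetLike.mem_coe, Submodule.mem_comap]
      rw [Finset.mem_coe, hE', Finset.mem_union, Finset.mem_union] at he
      rcases he with (he | he) | he
      · obtain ⟨⟨i, j⟩, h, rfl⟩ := Finset.mem_image.1 he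
        rw [foldMap_castSucc]
        exact memS _ (Finset.mem_filter.1 h).1
      · obtain ⟨w, h, rfl⟩ := Finset.mem_image.1 he
        have hn : (v, w) ∈ E ∨ (w, v) ∈ E := (hnbhd w).1 (by
          simp only [Finset.mem_union] at h ⊢; tauto)
        have hwv := hself w hn
        rw [foldMap_last v p w hwv]
        rcases hn with h | h
        · rw [hypRow_swap _ v w hwv.symm]
          exact S.neg_mem (memS _ h)
        · exact memS _ h
      · rw [Finset.mem_singleton.1 he, hypRow_last_self, foldMap_foldKer]
        exact S.zero_mem
    · rw [hS, Submodule.span_le]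
      rintro _ ⟨⟨i, j⟩, he, rfl⟩
      rw [Finset.mem_coe] at he
      by_cases h1 : i = v ∧ j ∈ C
      · obtain ⟨rfl, h1⟩ := h1
        rw [hypRow_swap _ j i (hCv j h1), ← foldMap_last i p j (hCv j h1)]
        exact (S'.map (foldMap i)).neg_mem
          (Submodule.mem_map_of_mem (memS' _ (hmem2 j (by simp [h1]))))
      · by_cases h2 : j = v ∧ i ∈ C
        · obtain ⟨rfl, h2⟩ := h2
          rw [← foldMap_last j p i (hCv i h2)]
          exact Submodule.mem_map_of_mem (memS' _ (hmem2 i (by simp [h2])))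
        · rw [← foldMap_castSucc v p i j]
          exact Submodule.mem_map_of_mem (memS' _ (hmem1 i j he h1 h2))
  have hrank : Module.finrank ℝ S' = Module.finrank ℝ S + d := by
    have h := LinearMap.finrank_range_add_finrank_ker ((foldMap (d := d) v).domRestrict S')
    rw [LinearMap.range_domRestrict, hmap, LinearMap.ker_domRestrict,
      (Submodule.comapSubtypeEquivOfLe hker).finrank_eq, finrank_ker_foldMap] at h
    exact h.symm
  refine ⟨by rw [hrank, hcard]; omega, ?_⟩
  intro hli
  have hr1 : Set.range (fun e : ↥(E : Set (Fin m × Fin m)) => hypRow p e.1)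
      = hypRow p '' (E : Set (Fin m × Fin m)) := by
    rw [Set.image_eq_range]
  have hr2 : Set.range (fun e : ↥(E' : Set (Fin (m + 1) × Fin (m + 1))) => hypRow q e.1)
      = hypRow q '' (E' : Set (Fin (m + 1) × Fin (m + 1))) := by
    rw [Set.image_eq_range]
  rw [linearIndependent_iff_card_eq_finrank_span, Set.finrank, hr1] at hli
  rw [linearIndependent_iff_card_eq_finrank_span, Set.finrank, hr2]
  rw [← hS] at hli
  rw [← hS', hrank, ← hli]
  simpa using hcard
end
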